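/- Let R be a Gorenstein ring, M a finitely generated R-module with canonical module K_M. Then K_M is an unmixed module (all of its associated primes have the same height, equal to the codimension of M). -/

import Mathlib

open CategoryTheory Opposite

noncomputable section

universe u

/-- The Ext modules `Ext^n_R(M, N)`. -/
noncomputable def RExt (R : Type) [CommRing R] (M N : ModuleCat R) (n : ℕ) : ModuleCat R :=
  ((Ext R (ModuleCat R) n).obj (op M)).obj N

/-- The (Krull) dimension of a module, i.e. the dimension of `R / Ann M`. -/
noncomputable def mDim (R : Type) [CommRing R] (M : Type) [AddCommGroup M] [Module R M] :
    WithBot (WithTop ℕ) :=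
  ringKrullDim (R ⧸ Module.annihilator R M)

/-- A (local) Gorenstein ring: Noetherian, local, and of finite self-injective dimension
(expressed via vanishing of `Ext^i(-, R)` for large `i`). -/
def IsGorensteinRing (R : Type) [CommRing R] : Prop :=
  IsNoetherianRing R ∧ IsLocalRing R ∧
    ∃ n : ℕ, ∀ (N : ModuleCat R) (i : ℕ), n < i →
      Subsingleton (RExt R N (ModuleCat.of R R) i)

/-- A module has finite projective dimension, expressed via vanishing of `Ext^i(M, -)`
for all large `i`. -/
def HasFiniteProjDim (R : Type) [CommRing R] (M : ModuleCat R) : Prop :=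
  ∃ n : ℕ, ∀ (N : ModuleCat R) (i : ℕ), n < i → Subsingleton (RExt R M N i)

/-- A finitely generated module over a Noetherian local ring is Cohen-Macaulay iff its depth
equals its dimension, i.e. `Ext^i(k, M) ≠ 0` forces `i = dim M`. -/
def IsCohenMacaulayMod (R : Type) [CommRing R] [IsLocalRing R] (M : ModuleCat R) : Prop :=
  ∀ i : ℕ,
    Nontrivial (RExt R (ModuleCat.of R (R ⧸ IsLocalRing.maximalIdeal R)) M i) →
      (i : WithBot (WithTop ℕ)) = mDim R M

/-- A perfect module: Cohen-Macaulay with finite projective dimension. -/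
def IsPerfectMod (R : Type) [CommRing R] [IsLocalRing R] (M : ModuleCat R) : Prop :=
  IsCohenMacaulayMod R M ∧ HasFiniteProjDim R M

/-- The "canonical module" `K_M = Ext^c_R(M, R)` of a module of codimension `c`
(in the local case, where no twist is needed). -/
noncomputable def KMod (R : Type) [CommRing R] (M : ModuleCat R) (c : ℕ) : ModuleCat R :=
  RExt R M (ModuleCat.of R R) c

/-- The height of a prime ideal. -/
noncomputable def pHeight (R : Type) [CommRing R] (p : Ideal R) (hp : p.IsPrime) :
    WithTop ℕ :=
  Order.height (⟨p, hp⟩ : PrimeSpectrum R)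

/-- A module is unmixed if all of its associated primes have the same height. -/
def IsUnmixedMod (R : Type) [CommRing R] (M : Type) [AddCommGroup M] [Module R M] : Prop :=
  ∀ p q, ∀ (hp : p ∈ associatedPrimes R M) (hq : q ∈ associatedPrimes R M),
    pHeight R p hp.isPrime = pHeight R q hq.isPrime

/-- A module has pure codimension `c` if all of its associated primes have height `c`. -/
def IsPureCodim (R : Type) [CommRing R] (M : Type) [AddCommGroup M] [Module R M] (c : ℕ) :
    Prop :=
  ∀ p, ∀ hp : p ∈ associatedPrimes R M, pHeight R p hp.isPrime = c

/-- A quasi-Gorenstein module of codimension `c`: a perfect module isomorphic to its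
canonical module (no twist in the local case). -/
def IsQuasiGorenstein (R : Type) [CommRing R] [IsLocalRing R] (M : ModuleCat R) (c : ℕ) :
    Prop :=
  IsPerfectMod R M ∧ mDim R M + (c : WithBot (WithTop ℕ)) = ringKrullDim R ∧
    Nonempty (M ≃ₗ[R] KMod R M c)

/-- A short exact sequence `0 → A → B → C → 0` of modules, given by linear maps. -/
def IsSES (R : Type) [CommRing R] {A B C : Type} [AddCommGroup A] [Module R A]
    [AddCommGroup B] [Module R B] [AddCommGroup C] [Module R C]
    (f : A →ₗ[R] B) (g : B →ₗ[R] C) : Prop :=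
  Function.Injective f ∧ Function.Surjective g ∧ Function.Exact f g

/-- `M` and `N` are directly module-linked by the quasi-Gorenstein module `C` of
codimension `c` (local case): both are unmixed of the same dimension as `C` and there are
the two standard exact sequences `0 → K_N → C → M → 0` and `0 → K_M → C → N → 0`. -/
def DirectlyLinked (R : Type) [CommRing R] [IsLocalRing R] (C M N : ModuleCat R) (c : ℕ) :
    Prop :=
  IsQuasiGorenstein R C c ∧
    IsUnmixedMod R M ∧ IsUnmixedMod R N ∧ mDim R M = mDim R C ∧ mDim R N = mDim R C ∧
    (∃ (f : KMod R N c →ₗ[R] C) (g : C →ₗ[R] M), IsSES R f g) ∧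
    (∃ (f : KMod R M c →ₗ[R] C) (g : C →ₗ[R] N), IsSES R f g)

/-- Being linked in `k` steps. -/
def LinkedChain (R : Type) [CommRing R] [IsLocalRing R] : ℕ → ModuleCat R → ModuleCat R → Prop
  | 0, M, N => Nonempty (M ≃ₗ[R] N)
  | (k + 1), M, N => ∃ (C P : ModuleCat R) (c : ℕ),
      DirectlyLinked R C M P c ∧ LinkedChain R k P N

end

noncomputable section

universe w v u

section Comparison
variable {R : Type*} [CommRing R] {C : Type u} [Category.{v} C] [Abelian C] [Linear R C]
  [HasExt.{w} C]

namespace CategoryTheory.ProjectiveResolution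
variable {X Y : C} (P : ProjectiveResolution X)

lemma extMk_smul {n : ℕ} (r : R) (f : P.complex.X n ⟶ Y) (m : ℕ) (hm : n + 1 = m)
    (hf : P.complex.d m n ≫ f = 0) :
    P.extMk (r • f) m hm (by simp [hf]) = r • P.extMk f m hm hf := by
  rw [Abelian.Ext.smul_eq_comp_mk₀, P.extMk_comp_mk₀]
  simp

lemma eq_zero_of_extMk_zero_eq_zero (f : P.complex.X 0 ⟶ Y) (m : ℕ) (hm : 0 + 1 = m)
    (hf : P.complex.d m 0 ≫ f = 0) (h : P.extMk f m hm hf = 0) : f = 0 := by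
  rw [← P.extEquivCohomologyClass.apply_eq_iff_eq,
    extEquivCohomologyClass_extMk, extEquivCohomologyClass_zero,
    CochainComplex.HomComplex.CohomologyClass.mk_eq_zero_iff,
    CochainComplex.HomComplex.Cocycle.toSingleMk_mem_coboundaries_iff _ _ _ _ _ 1 (by simp)] at h
  obtain ⟨g, hg⟩ := h
  have : Limits.IsZero (P.cochainComplex.X 1) :=
    CochainComplex.isZero_of_isStrictlyLE _ 0 1 (by lia)
  rw [this.eq_zero_of_src g, Limits.comp_zero] at hg
  exact (cancel_epi (P.cochainComplexXIso (-(0 : ℕ)) 0 rfl).hom).1 (by rw [← hg, Limits.comp_zero])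

/-- The linear map sending a cocycle to its class in `Ext`. -/
def cocyclesToExt (n : ℕ) :
    LinearMap.ker ((P.complex.linearYonedaObj R Y).sc n).g.hom →ₗ[R] Abelian.Ext X Y n where
  toFun f := P.extMk f.1 ((ComplexShape.up ℕ).next n) (by simp) f.2
  map_add' f g := (P.add_extMk _ _ _ _ _ _).symm
  map_smul' r f := P.extMk_smul r _ _ _ _

lemma cocyclesToExt_surjective (n : ℕ) :
    Function.Surjective (P.cocyclesToExt (R := R) (Y := Y) n) := by
  intro α
  obtain ⟨f, hf, rfl⟩ := P.extMk_surjective α ((ComplexShape.up ℕ).next n) (by simp)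
  exact ⟨⟨f, hf⟩, rfl⟩

lemma ker_cocyclesToExt (n : ℕ) :
    LinearMap.ker (P.cocyclesToExt (R := R) (Y := Y) n) =
      LinearMap.range ((P.complex.linearYonedaObj R Y).sc n).moduleCatToCycles := by
  ext f
  rw [LinearMap.mem_ker, LinearMap.mem_range]
  change P.extMk f.1 ((ComplexShape.up ℕ).next n) (by simp) f.2 = 0 ↔ _
  cases n with
  | zero =>
    have hd : ((P.complex.linearYonedaObj R Y).sc 0).f = 0 :=
      (P.complex.linearYonedaObj R Y).shape _ _ (by simp)
    constructor
    · intro h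
      refine ⟨0, (map_zero _).trans (Subtype.ext ?_)⟩
      exact (P.eq_zero_of_extMk_zero_eq_zero _ _ _ _ h).symm
    · rintro ⟨g, rfl⟩
      have hg : ((P.complex.linearYonedaObj R Y).sc 0).moduleCatToCycles g = 0 :=
        Subtype.ext (congrArg (fun φ => φ.hom g) hd)
      rw [hg]
      exact P.extMk_zero _ _
  | succ n =>
    refine (P.extMk_eq_zero_iff _ _ _ _ ((ComplexShape.up ℕ).prev (n + 1)) (by simp)).trans ?_
    exact ⟨fun ⟨g, hg⟩ => ⟨g, Subtype.ext hg⟩, fun ⟨g, hg⟩ => ⟨g, congrArg Subtype.val hg⟩⟩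

/-- `Ext` computed by deriving `Hom` agrees with `Ext` in the derived category. -/
def extLinearEquiv [EnoughProjectives C] (n : ℕ) :
    ((Ext R C n).obj (op X)).obj Y ≃ₗ[R] Abelian.Ext X Y n :=
  (P.isoExt n Y ≪≫ ((P.complex.linearYonedaObj R Y).sc n).moduleCatHomologyIso).toLinearEquiv ≪≫ₗ
    Submodule.quotEquivOfEq _ _ (P.ker_cocyclesToExt n).symm ≪≫ₗ
    (P.cocyclesToExt n).quotKerEquivOfSurjective (P.cocyclesToExt_surjective n)

end CategoryTheory.ProjectiveResolution
end Comparison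

section Algebra
variable {R : Type u} [CommRing R]

lemma subsingleton_ext_of_shortExact {S : ShortComplex (ModuleCat.{u} R)} (hS : S.ShortExact)
    (Y : ModuleCat.{u} R) (i : ℕ) (h₁ : Subsingleton (Abelian.Ext S.X₁ Y i))
    (h₃ : Subsingleton (Abelian.Ext S.X₃ Y i)) : Subsingleton (Abelian.Ext S.X₂ Y i) := by
  refine subsingleton_of_forall_eq 0 fun x => ?_
  obtain ⟨y, rfl⟩ := Abelian.Ext.contravariant_sequence_exact₂ hS Y x (Subsingleton.elim _ _)
  rw [Subsingleton.elim y 0, Abelian.Ext.comp_zero]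

lemma subsingleton_ext_of_linearEquiv {N N' : Type u} [AddCommGroup N] [Module R N]
    [AddCommGroup N'] [Module R N'] (e : N ≃ₗ[R] N') (Y : ModuleCat.{u} R) (i : ℕ)
    (h : Subsingleton (Abelian.Ext (ModuleCat.of R N') Y i)) :
    Subsingleton (Abelian.Ext (ModuleCat.of R N) Y i) := by
  refine subsingleton_of_forall_eq 0 fun x => ?_
  have hx : x = (Abelian.Ext.mk₀ e.toModuleIso.hom).comp
      ((Abelian.Ext.mk₀ e.toModuleIso.inv).comp x (zero_add i)) (zero_add i) := by
    rw [← Abelian.Ext.comp_assoc_of_second_deg_zero, Abelian.Ext.mk₀_comp_mk₀, Iso.hom_inv_id,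
      Abelian.Ext.mk₀_id_comp]
  rw [hx, Subsingleton.elim ((Abelian.Ext.mk₀ e.toModuleIso.inv).comp x (zero_add i)) 0,
    Abelian.Ext.comp_zero]

lemma mk₀_smul_id_comp {N Y : ModuleCat.{u} R} (x : R) {i : ℕ} (α : Abelian.Ext N Y i) :
    (Abelian.Ext.mk₀ (x • 𝟙 N)).comp α (zero_add i) = x • α := by
  simp [Abelian.Ext.mk₀_smul]

lemma smul_ext_eq_zero_of_mem_annihilator {N Y : ModuleCat.{u} R} {x : R}
    (hx : x ∈ Module.annihilator R N) {i : ℕ} (α : Abelian.Ext N Y i) : x • α = 0 := by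
  have h : x • 𝟙 N = 0 := by
    simp [← ModuleCat.lsmul_eq_smul_id, Module.mem_annihilator_iff_lsmul_eq_zero.mp hx]
  rw [← mk₀_smul_id_comp, h, Abelian.Ext.mk₀_zero, Abelian.Ext.zero_comp]

/-- Nakayama's lemma for `Ext`: if `x` in the maximal ideal is regular on `N` and
`Ext (N / x N) Y (i + 1)` vanishes, then so does `Ext N Y i`. -/
lemma subsingleton_ext_of_isSMulRegular [IsNoetherianRing R] [IsLocalRing R]
    {N Y : ModuleCat.{u} R} [Module.Finite R N] [Module.Finite R Y] {x : R}
    (hx : x ∈ IsLocalRing.maximalIdeal R) (hreg : IsSMulRegular N x) {i : ℕ}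
    (h : Subsingleton (Abelian.Ext (ModuleCat.of R (QuotSMulTop x N)) Y (i + 1))) :
    Subsingleton (Abelian.Ext N Y i) := by
  have hle : (⊤ : Submodule R (Abelian.Ext N Y i)) ≤ Ideal.span {x} • ⊤ := by
    intro α _
    obtain ⟨β, hβ⟩ := Abelian.Ext.contravariant_sequence_exact₁ hreg.smulShortComplex_shortExact
      Y α (add_comm 1 i) (@Subsingleton.elim _ h _ _)
    have hβ' : x • β = α := by
      rw [← hβ]
      exact (mk₀_smul_id_comp (N := N) x β).symm
    rw [← hβ']
    exact Submodule.smul_mem_smul (Ideal.mem_span_singleton_self x) trivial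
  have hbot := Submodule.eq_bot_of_le_smul_of_le_jacobson_bot (Ideal.span {x}) ⊤
    (Module.Finite.fg_top) hle
    (((Ideal.span_singleton_le_iff_mem _).2 hx).trans (IsLocalRing.maximalIdeal_le_jacobson _))
  exact (Submodule.subsingleton_iff R).1 (subsingleton_of_bot_eq_top hbot.symm)

/-- To show vanishing of `Ext N Y i` for finite modules `N` with dimension bounded by `n`, it
suffices to consider cyclic modules with prime annihilator. -/
lemma subsingleton_ext_of_forall_prime [IsNoetherianRing R] (Y : ModuleCat.{u} R) (i : ℕ)
    (n : WithBot ℕ∞) (h : ∀ p : PrimeSpectrum R, Module.supportDim R (R ⧸ p.asIdeal) ≤ n →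
      Subsingleton (Abelian.Ext (ModuleCat.of R (R ⧸ p.asIdeal)) Y i))
    (N : Type u) [AddCommGroup N] [Module R N] [hN : Module.Finite R N] :
    Module.supportDim R N ≤ n → Subsingleton (Abelian.Ext (ModuleCat.of R N) Y i) := by
  induction hN using IsNoetherianRing.induction_on_isQuotientEquivQuotientPrime R with
  | subsingleton N =>
    intro _
    refine subsingleton_of_forall_eq 0 fun x => ?_
    rw [← Abelian.Ext.mk₀_id_comp x,
      (ModuleCat.isZero_of_subsingleton (ModuleCat.of R N)).eq_zero_of_src (𝟙 _),
      Abelian.Ext.mk₀_zero, Abelian.Ext.zero_comp]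
  | quotient N p e =>
    intro hd
    exact subsingleton_ext_of_linearEquiv e Y i
      (h p (by rwa [← Module.supportDim_eq_of_equiv e]))
  | exact N₁ N₂ N₃ f g hf hg hfg h₁ h₃ =>
    intro hd
    let S : ShortComplex (ModuleCat.{u} R) :=
      ShortComplex.mk (ModuleCat.ofHom f) (ModuleCat.ofHom g)
        (by ext x; exact hfg.apply_apply_eq_zero x)
    have hS : S.ShortExact :=
      { exact := (ShortComplex.ShortExact.moduleCat_exact_iff_function_exact S).2 hfg
        mono_f := (ModuleCat.mono_iff_injective _).2 hf
        epi_g := (ModuleCat.epi_iff_surjective _).2 hg }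
    exact subsingleton_ext_of_shortExact hS Y i
      (h₁ ((Module.supportDim_le_of_injective f hf).trans hd))
      (h₃ ((Module.supportDim_le_of_surjective g hg).trans hd))

lemma annihilator_smul_top_lt_top [IsLocalRing R] (N Y : Type u) [AddCommGroup N] [Module R N]
    [Nontrivial N] [AddCommGroup Y] [Module R Y] [Module.Finite R Y] [Nontrivial Y] :
    Module.annihilator R N • (⊤ : Submodule R Y) < ⊤ :=
  (Submodule.top_ne_ideal_smul_of_le_jacobson_annihilator
    ((IsLocalRing.le_maximalIdeal (Module.annihilator_eq_top_iff.not.2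
      (not_subsingleton N))).trans (IsLocalRing.maximalIdeal_le_jacobson _))).symm.lt_top

/-- If `rs` is a `Y`-regular sequence annihilating `N`, then `Ext N Y rs.length` is
`Hom(N, Y / rs Y)`. -/
lemma nonempty_ext_equiv_linearMap_of_isRegular [IsNoetherianRing R] [IsLocalRing R]
    (N : ModuleCat.{u} R) [Module.Finite R N] [Nontrivial N] (rs : List R)
    (hrs : ∀ r ∈ rs, r ∈ Module.annihilator R N) (Y : Type u) [AddCommGroup Y] [Module R Y]
    [Module.Finite R Y] (hreg : RingTheory.Sequence.IsRegular Y rs) :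
    Nonempty (Abelian.Ext N (ModuleCat.of R Y) rs.length ≃ₗ[R]
      (N →ₗ[R] Y ⧸ (Ideal.ofList rs • ⊤ : Submodule R Y))) := by
  induction rs generalizing Y with
  | nil =>
    exact ⟨Abelian.Ext.linearEquiv₀ ≪≫ₗ ModuleCat.homLinearEquiv ≪≫ₗ
      LinearEquiv.congrRight (Submodule.quotEquivOfEqBot _ (by simp)).symm⟩
  | cons a rs ih =>
    have hY := hreg.nontrivial
    have hvan : Subsingleton (Abelian.Ext N (ModuleCat.of R Y) rs.length) :=
      ModuleCat.subsingleton_ext_of_exists_isRegular (Module.annihilator R N) N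
        (by rw [Module.support_eq_zeroLocus]) (ModuleCat.of R Y)
        (annihilator_smul_top_lt_top N Y) (a :: rs) hrs hreg rs.length (by simp)
    rw [RingTheory.Sequence.isRegular_cons_iff] at hreg
    obtain ⟨e⟩ := ih (fun r hr => hrs r (List.mem_cons_of_mem _ hr)) (QuotSMulTop a Y) hreg.2
    have hS := (show IsSMulRegular (ModuleCat.of R Y) a from hreg.1).smulShortComplex_shortExact
    let δ : Abelian.Ext N (ModuleCat.of R (QuotSMulTop a Y)) rs.length →ₗ[R]
        Abelian.Ext N (ModuleCat.of R Y) (rs.length + 1) :=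
      hS.extClass.postcompOfLinear R N rfl
    have hδ : Function.Bijective δ := by
      refine ⟨(injective_iff_map_eq_zero δ).2 fun x hx => ?_, fun x => ?_⟩
      · obtain ⟨y, rfl⟩ := Abelian.Ext.covariant_sequence_exact₃ N hS x rfl hx
        rw [show y = 0 from @Subsingleton.elim _ hvan _ _, Abelian.Ext.zero_comp]
        rfl
      · refine Abelian.Ext.covariant_sequence_exact₁ N hS x ?_ rfl
        exact (Abelian.Ext.smul_eq_comp_mk₀ x a).symm.trans
          (smul_ext_eq_zero_of_mem_annihilator (hrs a List.mem_cons_self) x)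
    exact ⟨(LinearEquiv.ofBijective δ hδ).symm ≪≫ₗ e ≪≫ₗ LinearEquiv.congrRight
      (Submodule.quotOfListConsSMulTopEquivQuotSMulTopInner Y a rs).symm⟩

lemma exists_mem_maximalIdeal_isSMulRegular [IsLocalRing R] (p : Ideal R) [p.IsPrime]
    (hp : p ≠ IsLocalRing.maximalIdeal R) :
    ∃ x ∈ IsLocalRing.maximalIdeal R, IsSMulRegular (R ⧸ p) x := by
  obtain ⟨x, hx, hxp⟩ := SetLike.exists_of_lt
    ((IsLocalRing.le_maximalIdeal (Ideal.IsPrime.ne_top ‹_›)).lt_of_ne hp)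
  refine ⟨x, hx, isSMulRegular_iff_right_eq_zero_of_smul.2 fun y hy => ?_⟩
  rw [Algebra.smul_def] at hy
  exact (mul_eq_zero.1 hy).resolve_left fun h => hxp (Ideal.Quotient.eq_zero_iff_mem.1 h)

/-- Ischebeck's theorem: if `Ext k Y i = 0` for `i < t`, then `Ext N Y i = 0` for
`i + dim N < t`. -/
lemma subsingleton_ext_of_supportDim_le [IsNoetherianRing R] [IsLocalRing R]
    (Y : ModuleCat.{u} R) [Module.Finite R Y] (t : ℕ)
    (ht : ∀ i < t, Subsingleton
      (Abelian.Ext (ModuleCat.of R (R ⧸ IsLocalRing.maximalIdeal R)) Y i))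
    (n : ℕ) (N : Type u) [AddCommGroup N] [Module R N] [Module.Finite R N]
    (hN : Module.supportDim R N ≤ n) (i : ℕ) (hi : i + n < t) :
    Subsingleton (Abelian.Ext (ModuleCat.of R N) Y i) := by
  induction n generalizing N i with
  | zero =>
    refine subsingleton_ext_of_forall_prime Y i (0 : ℕ) (fun p hp => ?_) N hN
    by_cases hpm : p.asIdeal = IsLocalRing.maximalIdeal R
    · rw [hpm]
      exact ht i (by lia)
    · obtain ⟨x, hx, hreg⟩ := exists_mem_maximalIdeal_isSMulRegular p.asIdeal hpm
      rw [← Module.supportDim_quotSMulTop_succ_eq_supportDim hreg hx, Nat.cast_zero,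
        ENat.WithBot.add_one_le_zero_iff, Module.supportDim_eq_bot_iff_subsingleton] at hp
      exact (not_nontrivial_iff_subsingleton.2 hp
        (nontrivial_quotSMulTop_of_mem_maximalIdeal _ hx)).elim
  | succ n ih =>
    refine subsingleton_ext_of_forall_prime Y i (n + 1 : ℕ) (fun p hp => ?_) N hN
    by_cases hpm : p.asIdeal = IsLocalRing.maximalIdeal R
    · rw [hpm]
      exact ht i (by lia)
    · obtain ⟨x, hx, hreg⟩ := exists_mem_maximalIdeal_isSMulRegular p.asIdeal hpm
      rw [← Module.supportDim_quotSMulTop_succ_eq_supportDim hreg hx, Nat.cast_add, Nat.cast_one,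
        ENat.WithBot.add_le_add_one_right_iff] at hp
      exact subsingleton_ext_of_isSMulRegular (N := ModuleCat.of R (R ⧸ p.asIdeal)) hx hreg
        (ih _ hp (i + 1) (by lia))


/-- If `k` embeds into a finite module `S` and `Ext S Y j = 0`, then vanishing of `Ext - Y (j + 1)`
on finite modules implies vanishing of `Ext - Y j`. -/
lemma subsingleton_ext_of_residue_injective [IsNoetherianRing R] [IsLocalRing R]
    (Y : ModuleCat.{u} R) [Module.Finite R Y] (S : Type u) [AddCommGroup S] [Module R S]
    [Module.Finite R S] (f : (R ⧸ IsLocalRing.maximalIdeal R) →ₗ[R] S)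
    (hf : Function.Injective f) (j : ℕ) (hS : Subsingleton (Abelian.Ext (ModuleCat.of R S) Y j))
    (h : ∀ (N : Type u) [AddCommGroup N] [Module R N] [Module.Finite R N],
      Subsingleton (Abelian.Ext (ModuleCat.of R N) Y (j + 1)))
    (N : Type u) [AddCommGroup N] [Module R N] [Module.Finite R N] :
    Subsingleton (Abelian.Ext (ModuleCat.of R N) Y j) := by
  refine subsingleton_ext_of_forall_prime Y j ⊤ (fun p _ => ?_) N le_top
  by_cases hpm : p.asIdeal = IsLocalRing.maximalIdeal R
  · rw [hpm]
    let T : ShortComplex (ModuleCat.{u} R) :=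
      ShortComplex.mk (ModuleCat.ofHom f) (ModuleCat.ofHom (LinearMap.range f).mkQ)
        (ModuleCat.hom_ext (LinearMap.exact_map_mkQ_range f).linearMap_comp_eq_zero)
    have hT : T.ShortExact :=
      { exact := (ShortComplex.ShortExact.moduleCat_exact_iff_function_exact T).2
          (LinearMap.exact_map_mkQ_range f)
        mono_f := (ModuleCat.mono_iff_injective _).2 hf
        epi_g := (ModuleCat.epi_iff_surjective _).2 (Submodule.mkQ_surjective _) }
    refine subsingleton_of_forall_eq 0 fun α => ?_
    obtain ⟨β, hβ⟩ := Abelian.Ext.contravariant_sequence_exact₁ hT Y α (add_comm 1 j)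
      (@Subsingleton.elim _ (h (S ⧸ LinearMap.range f)) _ _)
    rw [← hβ, show β = 0 from @Subsingleton.elim _ hS _ _, Abelian.Ext.comp_zero]
  · obtain ⟨x, hx, hreg⟩ := exists_mem_maximalIdeal_isSMulRegular p.asIdeal hpm
    exact subsingleton_ext_of_isSMulRegular (N := ModuleCat.of R (R ⧸ p.asIdeal)) hx hreg (h _)

lemma not_subsingleton_ext_of_linearMap_ne_zero [IsNoetherianRing R] [IsLocalRing R] {rs : List R}
    (hreg : RingTheory.Sequence.IsRegular R rs) {p : Ideal R} [p.IsPrime] (hrs : ∀ r ∈ rs, r ∈ p)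
    {f : (R ⧸ p) →ₗ[R] R ⧸ (Ideal.ofList rs • ⊤ : Submodule R R)} (hf : f ≠ 0) :
    ¬ Subsingleton (Abelian.Ext (ModuleCat.of R (R ⧸ p)) (ModuleCat.of R R) rs.length) := by
  intro h
  have : Nontrivial (ModuleCat.of R (R ⧸ p)) := inferInstanceAs (Nontrivial (R ⧸ p))
  obtain ⟨e⟩ := nonempty_ext_equiv_linearMap_of_isRegular (ModuleCat.of R (R ⧸ p)) rs
    (fun r hr => Ideal.annihilator_quotient.ge (hrs r hr)) R hreg
  exact hf (@Subsingleton.elim _ e.symm.toEquiv.subsingleton f 0)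

lemma exists_ringKrullDim_eq_natCast (R : Type*) [CommRing R] [FiniteRingKrullDim R] :
    ∃ d : ℕ, ringKrullDim R = d := by
  obtain ⟨e, he⟩ := WithBot.ne_bot_iff_exists.1 (ringKrullDim_ne_bot (R := R))
  obtain ⟨d, rfl⟩ := ENat.ne_top_iff_exists.1
    (fun h : e = ⊤ => ringKrullDim_ne_top (R := R) (by rw [← he, h, WithBot.coe_top]))
  exact ⟨d, he.symm⟩

lemma exists_supportDim_eq_natCast [IsNoetherianRing R] [IsLocalRing R] (N : Type*)
    [AddCommGroup N] [Module R N] [Module.Finite R N] [Nontrivial N] :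
    ∃ d : ℕ, Module.supportDim R N = d := by
  have : Nontrivial (R ⧸ Module.annihilator R N) := Ideal.Quotient.nontrivial_iff.2
    (Module.annihilator_eq_top_iff.not.2 (not_subsingleton N))
  have : IsLocalRing (R ⧸ Module.annihilator R N) :=
    .of_surjective' (Ideal.Quotient.mk _) Ideal.Quotient.mk_surjective
  rw [Module.supportDim_eq_ringKrullDim_quotient_annihilator]
  exact exists_ringKrullDim_eq_natCast _

lemma length_le_of_isRegular [IsNoetherianRing R] [IsLocalRing R] {rs : List R}
    (hreg : RingTheory.Sequence.IsRegular R rs) : (rs.length : WithBot ℕ∞) ≤ ringKrullDim R := by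
  have : Nontrivial (R ⧸ Ideal.ofList rs) := Ideal.Quotient.nontrivial_iff.2
    (by simpa using hreg.2.symm)
  rw [← ringKrullDim_add_length_eq_ringKrullDim_of_isRegular rs hreg]
  exact le_add_of_nonneg_left ringKrullDim_nonneg_of_nontrivial

/-- A local ring whose `Ext`-functors into itself vanish in high degrees has depth at least its
dimension. -/
lemma exists_ringKrullDim_le_and_subsingleton_ext [IsNoetherianRing R] [IsLocalRing R] (r : ℕ)
    (hr : ∀ (N : Type u) [AddCommGroup N] [Module R N] [Module.Finite R N] (i : ℕ), r < i →
      Subsingleton (Abelian.Ext (ModuleCat.of R N) (ModuleCat.of R R) i)) :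
    ∃ t : ℕ, ringKrullDim R ≤ t ∧ ∀ i < t, Subsingleton
      (Abelian.Ext (ModuleCat.of R (R ⧸ IsLocalRing.maximalIdeal R)) (ModuleCat.of R R) i) := by
  set k := ModuleCat.of R (R ⧸ IsLocalRing.maximalIdeal R)
  have : Module.Finite R k := inferInstanceAs (Module.Finite R (R ⧸ IsLocalRing.maximalIdeal R))
  have : Nontrivial k := inferInstanceAs (Nontrivial (R ⧸ IsLocalRing.maximalIdeal R))
  have hann : Module.annihilator R k = IsLocalRing.maximalIdeal R := Ideal.annihilator_quotient
  have hrees (n : ℕ) (h : ∀ i < n, Subsingleton (Abelian.Ext k (ModuleCat.of R R) i)) :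
      ∃ rs : List R, rs.length = n ∧ (∀ r ∈ rs, r ∈ IsLocalRing.maximalIdeal R) ∧
        RingTheory.Sequence.IsRegular R rs := by
    rw [← hann]
    exact ModuleCat.exists_isRegular_of_exists_subsingleton_ext (Module.annihilator R k) n
      (ModuleCat.of R R) (annihilator_smul_top_lt_top k R) k
      (by rw [Module.support_eq_zeroLocus]) h
  have hex : ∃ i, ¬ Subsingleton (Abelian.Ext k (ModuleCat.of R R) i) := by
    by_contra! hall
    obtain ⟨d, hd⟩ := exists_ringKrullDim_eq_natCast R
    obtain ⟨rs, hlen, -, hreg⟩ := hrees (d + 1) (fun i _ => hall i)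
    have hle := length_le_of_isRegular hreg
    rw [hd, hlen, Nat.cast_le] at hle
    lia
  classical
  set t := Nat.find hex
  have hne : ¬ Subsingleton (Abelian.Ext k (ModuleCat.of R R) t) := Nat.find_spec hex
  have hlt : ∀ i < t, Subsingleton (Abelian.Ext k (ModuleCat.of R R) i) :=
    fun i hi => not_not.1 (Nat.find_min hex hi)
  clear_value t
  refine ⟨t, ?_, hlt⟩
  obtain ⟨rs, rfl, hmem, hreg⟩ := hrees t hlt
  set S := R ⧸ (Ideal.ofList rs • ⊤ : Submodule R R)
  obtain ⟨f, hf⟩ : ∃ f : (R ⧸ IsLocalRing.maximalIdeal R) →ₗ[R] S, f ≠ 0 := by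
    by_contra! hall
    obtain ⟨e⟩ := nonempty_ext_equiv_linearMap_of_isRegular k rs (by rwa [hann]) R hreg
    exact hne (@Equiv.subsingleton _ _ e.toEquiv (subsingleton_of_forall_eq 0 hall))
  have : IsSimpleModule R (R ⧸ IsLocalRing.maximalIdeal R) :=
    isSimpleModule_iff_isCoatom.2 (Ideal.isMaximal_def.1 inferInstance)
  have hS (j : ℕ) (hj : rs.length < j) :
      Subsingleton (Abelian.Ext (ModuleCat.of R S) (ModuleCat.of R R) j) := by
    have hpd : HasProjectiveDimensionLE (ModuleCat.of R S) rs.length := by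
      rw [← projectiveDimension_le_iff]
      refine (ModuleCat.projectiveDimension_quotient_eq_add_length_of_isWeaklyRegular
        (ModuleCat.of R R) rs hreg.1 hmem).trans_le ?_
      rw [ModuleCat.projectiveDimension_eq_zero_of_projective, zero_add]
    exact hpd.subsingleton _ _ j hj _
  have hP (n : ℕ) : (∀ (N : Type u) [AddCommGroup N] [Module R N] [Module.Finite R N] (i : ℕ),
      rs.length + n < i → Subsingleton (Abelian.Ext (ModuleCat.of R N) (ModuleCat.of R R) i)) →
      ∀ (N : Type u) [AddCommGroup N] [Module R N] [Module.Finite R N] (i : ℕ),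
      rs.length < i → Subsingleton (Abelian.Ext (ModuleCat.of R N) (ModuleCat.of R R) i) := by
    induction n with
    | zero => exact id
    | succ n ih =>
      refine fun h => ih fun N _ _ _ i hi => ?_
      exact subsingleton_ext_of_residue_injective (ModuleCat.of R R) S f
        (LinearMap.injective_of_ne_zero hf) i (hS i (by lia))
        (fun N _ _ _ => h N (i + 1) (by lia)) N
  have htop := hP r fun N _ _ _ i hi => hr N i (by lia)
  have hmax (q : Ideal R) (hq : q ∈ (Ideal.ofList rs).minimalPrimes) :
      q = IsLocalRing.maximalIdeal R := by
    have := hq.1.1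
    by_contra hqm
    have hqS : q ∈ associatedPrimes R S := by
      refine Module.associatedPrimes.minimalPrimes_annihilator_subset_associatedPrimes R S ?_
      have hSann : Module.annihilator R S = Ideal.ofList rs := by
        rw [Ideal.annihilator_quotient (I := Ideal.ofList rs • ⊤), smul_eq_mul, Ideal.mul_top]
      rwa [hSann]
    obtain ⟨-, g, hg⟩ := isAssociatedPrime_iff_exists_injective_linearMap _ _ |>.1 hqS
    obtain ⟨x, hx, hxreg⟩ := exists_mem_maximalIdeal_isSMulRegular q hqm
    refine not_subsingleton_ext_of_linearMap_ne_zero hreg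
      (fun r hr => hq.1.2 (Ideal.subset_span hr)) (f := g) ?_
      (subsingleton_ext_of_isSMulRegular (N := ModuleCat.of R (R ⧸ q)) hx hxreg
        (htop _ _ (Nat.lt_succ_self _)))
    rintro rfl
    exact zero_ne_one (hg (show (0 : (R ⧸ q) →ₗ[R] S) 0 = (0 : (R ⧸ q) →ₗ[R] S) 1 from rfl))
  have hdim : ringKrullDim (R ⧸ Ideal.ofList rs) ≤ 0 := by
    rw [ringKrullDim_quotient, Order.krullDim_nonpos_iff_forall_isMax]
    intro p p₂ _
    obtain ⟨q, hq, hqp⟩ := Ideal.exists_minimalPrimes_le (J := p.1.asIdeal) p.2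
    exact (IsLocalRing.le_maximalIdeal p₂.1.isPrime.ne_top).trans ((hmax q hq).ge.trans hqp)
  rw [← ringKrullDim_add_length_eq_ringKrullDim_of_isRegular rs hreg]
  simpa using add_le_add_left hdim (rs.length : WithBot ℕ∞)

/-- Height plus coheight of a prime is at most the dimension. -/
lemma height_add_supportDim_quotient_le (p : PrimeSpectrum R) :
    (Order.height p : WithBot ℕ∞) + Module.supportDim R (R ⧸ p.asIdeal) ≤ ringKrullDim R := by
  have hco : Module.supportDim R (R ⧸ p.asIdeal) = (Order.coheight p : WithBot ℕ∞) := by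
    rw [Module.supportDim_quotient_eq_ringKrullDim, ringKrullDim_quotient,
      Order.coheight_eq_krullDim_Ici]
    rfl
  have : Nonempty (PrimeSpectrum R) := ⟨p⟩
  rw [hco, ringKrullDim, Order.krullDim_eq_iSup_height_add_coheight_of_nonempty, ← WithBot.coe_add,
    WithBot.coe_le_coe]
  exact le_iSup (fun q : PrimeSpectrum R => Order.height q + Order.coheight q) p

lemma length_le_height_of_isRegular [IsNoetherianRing R] {rs : List R}
    (hreg : RingTheory.Sequence.IsRegular R rs) (p : PrimeSpectrum R)
    (hrs : ∀ r ∈ rs, r ∈ p.asIdeal) : (rs.length : ℕ∞) ≤ Order.height p := by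
  have h := length_le_of_isRegular (hreg.1.isRegular_of_isLocalization_of_mem
    (Localization.AtPrime p.asIdeal) p.asIdeal hrs)
  rw [List.length_map, IsLocalization.AtPrime.ringKrullDim_eq_height p.asIdeal,
    PrimeSpectrum.height_eq_orderHeight] at h
  exact_mod_cast h

/-- Over a local ring `R` whose `Ext`-functors into itself vanish in high degrees, the associated
primes of `Ext M R c` have height `c`, where `c` is the codimension of `M`. -/
lemma height_eq_of_isAssociatedPrime_ext [IsNoetherianRing R] [IsLocalRing R] (r : ℕ)
    (hr : ∀ (N : Type u) [AddCommGroup N] [Module R N] [Module.Finite R N] (i : ℕ), r < i →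
      Subsingleton (Abelian.Ext (ModuleCat.of R N) (ModuleCat.of R R) i))
    (M : ModuleCat.{u} R) [Module.Finite R M] (c : ℕ)
    (hc : Module.supportDim R M + c = ringKrullDim R) (p : PrimeSpectrum R)
    (hp : IsAssociatedPrime p.asIdeal (Abelian.Ext M (ModuleCat.of R R) c)) :
    Order.height p = c := by
  obtain ⟨t, hdt, ht⟩ := exists_ringKrullDim_le_and_subsingleton_ext r hr
  obtain ⟨d, hd⟩ := exists_ringKrullDim_eq_natCast R
  rw [hd, Nat.cast_le] at hdt
  rw [hd] at hc
  have : Nontrivial M := by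
    rw [← Module.supportDim_ne_bot_iff_nontrivial R]
    intro h
    rw [h, WithBot.bot_add] at hc
    exact WithBot.bot_ne_coe hc
  obtain ⟨m, hm⟩ := exists_supportDim_eq_natCast (R := R) M
  have hmc : m + c = d := by
    rw [hm] at hc
    exact_mod_cast hc
  obtain ⟨rs, rfl, hmem, hreg⟩ := ModuleCat.exists_isRegular_of_exists_subsingleton_ext
    (Module.annihilator R M) c (ModuleCat.of R R) (annihilator_smul_top_lt_top M R) M
    (by rw [Module.support_eq_zeroLocus]) fun i hi =>
      subsingleton_ext_of_supportDim_le (ModuleCat.of R R) t ht m M hm.le i (by lia)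
  obtain ⟨e⟩ := nonempty_ext_equiv_linearMap_of_isRegular M rs hmem R hreg
  rw [LinearEquiv.isAssociatedPrime_iff e, isAssociatedPrime_iff_exists_injective_linearMap] at hp
  obtain ⟨-, f, hf⟩ := hp
  have hf₁ : f 1 ≠ 0 := fun h => one_ne_zero (hf (h.trans (map_zero f).symm))
  obtain ⟨y, hy⟩ := DFunLike.ne_iff.1 hf₁
  have hrsp (r : R) (hr : r ∈ rs) : r ∈ p.asIdeal := by
    rw [← Ideal.Quotient.eq_zero_iff_mem]
    refine hf (LinearMap.ext fun z => ?_)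
    have : (Ideal.Quotient.mk p.asIdeal r) = r • (1 : R ⧸ p.asIdeal) := by
      rw [Algebra.smul_def, mul_one]
      rfl
    rw [this, map_smul, map_zero, LinearMap.smul_apply, ← map_smul,
      Module.mem_annihilator.1 (hmem r hr), map_zero, LinearMap.zero_apply]
  refine le_antisymm ?_ (length_le_height_of_isRegular hreg p hrsp)
  have hne := not_subsingleton_ext_of_linearMap_ne_zero hreg hrsp
    (f := (LinearMap.applyₗ y).comp f) fun h => hy (LinearMap.congr_fun h 1)
  have hle := height_add_supportDim_quotient_le p
  obtain ⟨s, hs⟩ := exists_supportDim_eq_natCast (R := R) (R ⧸ p.asIdeal)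
  have hst : t ≤ rs.length + s := by
    by_contra! hlt
    exact hne (subsingleton_ext_of_supportDim_le (ModuleCat.of R R) t ht s (R ⧸ p.asIdeal)
      hs.le _ hlt)
  rw [hs, hd] at hle
  have hle' : Order.height p + s ≤ (d : ℕ∞) := by exact_mod_cast hle
  have h₂ : Order.height p + s ≤ (rs.length : ℕ∞) + s :=
    hle'.trans (by exact_mod_cast hdt.trans hst)
  exact (ENat.add_le_add_iff_right (ENat.natCast_ne_top s)).1 h₂

end Algebra

end

/-- Over a Gorenstein ring, the canonical module `K_M` of a finitely
generated module `M` of codimension `c` is unmixed: all its associated primes have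
height `c`. -/
theorem canonicalModule_isUnmixed
    (R : Type) [CommRing R] (hGor : IsGorensteinRing R)
    (M : ModuleCat R) [Module.Finite R M] (c : ℕ)
    (hc : mDim R M + (c : WithBot (WithTop ℕ)) = ringKrullDim R) :
    IsUnmixedMod R (KMod R M c) ∧ IsPureCodim R (KMod R M c) c := by
  obtain ⟨hN, hL, r, hr⟩ := hGor
  have key : IsPureCodim R (KMod R M c) c := by
    intro p hp
    refine height_eq_of_isAssociatedPrime_ext r (fun N _ _ _ i hi => ?_) M c ?_
      ⟨p, hp.isPrime⟩ ?_
    · exact @Equiv.subsingleton _ _ ((projectiveResolution (ModuleCat.of R N)).extLinearEquiv (R := R)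
        (Y := ModuleCat.of R R) i).symm.toEquiv (hr (ModuleCat.of R N) i hi)
    · rw [Module.supportDim_eq_ringKrullDim_quotient_annihilator]
      exact hc
    · exact (LinearEquiv.isAssociatedPrime_iff
        ((projectiveResolution M).extLinearEquiv (R := R) (Y := ModuleCat.of R R) c)).1 hp
  exact ⟨fun p q hp hq => (key p hp).trans (key q hq).symm, key⟩
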